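/- arXiv:2409.14053 — 2 statements merged into one kernel-verified Lean document; each statement's English description precedes it below -/
import Mathlib

section
/- Let d, N ≥ 1, T > 0, and let G : P_2(ℝ^d) → ℝ be bounded from below. Then for every t ∈ [0,T) and x ∈ (ℝ^d)^N, V^N(t,x) = inf_{y ∈ (ℝ^d)^N} { G(m_y^N) + (1/(2(T−t))) d_2(m_x^N, m_y^N)² }; that is, in the Hopf–Lax formula for V^N the normalized sum of squared coordinate distances may be replaced by the squared 2-Wasserstein distance between the empirical measures. -/
open MeasureTheory Filter
open scoped ENNReal NNReal BigOperators

noncomputable section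

/-- `Ed d` is the Euclidean space `ℝ^d`. -/
abbrev Ed (d : ℕ) := EuclideanSpace ℝ (Fin d)

/-- A Borel probability measure on `ℝ^d` with finite second moment,
i.e. an element of `P_2(ℝ^d)`. -/
def IsP2 {d : ℕ} (μ : Measure (Ed d)) : Prop :=
  IsProbabilityMeasure μ ∧ Integrable (fun x => ‖x‖ ^ 2) μ

/-- The empirical measure `m_x^N = (1/N) ∑ δ_{x^i}`. -/
def empMeas {d N : ℕ} (x : Fin N → Ed d) : Measure (Ed d) :=
  (N : ℝ≥0∞)⁻¹ • ∑ i, Measure.dirac (x i)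

/-- `π` is a coupling of `μ` and `ν`. -/
def IsCoupling {d : ℕ} (π : Measure (Ed d × Ed d)) (μ ν : Measure (Ed d)) : Prop :=
  IsProbabilityMeasure π ∧ π.map Prod.fst = μ ∧ π.map Prod.snd = ν

/-- The squared 2-Wasserstein distance `d_2(μ,ν)²`, as the infimum over couplings of
`∫ |x - y|² dπ(x,y)` (with value in `[0,∞]`). -/
def d2sq {d : ℕ} (μ ν : Measure (Ed d)) : ℝ≥0∞ :=
  ⨅ (π : Measure (Ed d × Ed d)) (_ : IsCoupling π μ ν),
    ∫⁻ p, (‖p.1 - p.2‖₊ : ℝ≥0∞) ^ 2 ∂π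

/-- The 2-Wasserstein distance `d_2(μ,ν)`. -/
def d2 {d : ℕ} (μ ν : Measure (Ed d)) : ℝ := Real.sqrt (d2sq μ ν).toReal

/-- The 1-Wasserstein distance, via Kantorovich duality:
`d_1(μ,ν) = sup { ∫ f dμ - ∫ f dν : f 1-Lipschitz }`. -/
def d1 {d : ℕ} (μ ν : Measure (Ed d)) : ℝ :=
  sSup { r | ∃ f : Ed d → ℝ, LipschitzWith 1 f ∧ r = (∫ x, f x ∂μ) - ∫ x, f x ∂ν }

/-- The Hopf–Lax mean-field value function
`U(t,m) = inf_{ν ∈ P_2} { G(ν) + d_2(m,ν)²/(2(T-t)) }`. -/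
def MFval {d : ℕ} (T : ℝ) (G : Measure (Ed d) → ℝ) (t : ℝ) (m : Measure (Ed d)) : ℝ :=
  sInf { r | ∃ ν : Measure (Ed d), IsP2 ν ∧
    r = G ν + (d2sq m ν).toReal / (2 * (T - t)) }

/-- The Hopf–Lax `N`-particle value function
`V^N(t,x) = inf_y { G(m_y^N) + (1/(2(T-t)N)) ∑ |x^i - y^i|² }`. -/
def NPval {d N : ℕ} (T : ℝ) (G : Measure (Ed d) → ℝ) (t : ℝ) (x : Fin N → Ed d) : ℝ :=
  sInf { r | ∃ y : Fin N → Ed d,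
    r = G (empMeas y) + (1 / (2 * (T - t) * (N : ℝ))) * ∑ i, ‖x i - y i‖ ^ 2 }

/-- A linear functional on the doubly stochastic matrices is minimized by a permutation. -/
lemma exists_perm_sum_le_of_mem_doublyStochastic {n : Type*} [Fintype n] [DecidableEq n]
    (C : n → n → ℝ) :
    ∃ σ : Equiv.Perm n, ∀ M ∈ doublyStochastic ℝ n,
      ∑ i, C i (σ i) ≤ ∑ i, ∑ j, C i j * M i j := by
  obtain ⟨σ, hσ⟩ := Finite.exists_min fun σ : Equiv.Perm n => ∑ i, C i (σ i)
  refine ⟨σ, fun M hM => ?_⟩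
  obtain ⟨w, hw0, hw1, rfl⟩ := exists_eq_sum_perm_of_mem_doublyStochastic hM
  have hperm : ∀ τ : Equiv.Perm n, ∑ i, ∑ j, C i j * τ.permMatrix ℝ i j = ∑ i, C i (τ i) := by
    intro τ
    simp [PEquiv.toMatrix_apply, Equiv.toPEquiv_apply]
  calc ∑ i, C i (σ i) = ∑ τ, w τ * ∑ i, C i (σ i) := by rw [← Finset.sum_mul, hw1, one_mul]
    _ ≤ ∑ τ, w τ * ∑ i, C i (τ i) :=
      Finset.sum_le_sum fun τ _ => mul_le_mul_of_nonneg_left (hσ τ) (hw0 τ)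
    _ = ∑ τ, w τ * ∑ i, ∑ j, C i j * τ.permMatrix ℝ i j := by simp_rw [hperm]
    _ = ∑ i, ∑ j, C i j * (∑ τ, w τ • τ.permMatrix ℝ) i j := by
      simp_rw [Matrix.sum_apply, Matrix.smul_apply, smul_eq_mul, Finset.mul_sum]
      rw [Finset.sum_comm]
      refine Finset.sum_congr rfl fun i _ => ?_
      rw [Finset.sum_comm]
      exact Finset.sum_congr rfl fun j _ => Finset.sum_congr rfl fun τ _ => by ring

section empMeas

variable {d N : ℕ}

lemma lintegral_empMeas (x : Fin N → Ed d) (f : Ed d → ℝ≥0∞) :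
    ∫⁻ a, f a ∂empMeas x = (N : ℝ≥0∞)⁻¹ * ∑ i, f (x i) := by
  simp [empMeas, lintegral_smul_measure, lintegral_finsetSum_measure]

lemma isProbabilityMeasure_inv_smul_sum_dirac {α : Type*} [MeasurableSpace α] (hN : N ≠ 0)
    (z : Fin N → α) :
    IsProbabilityMeasure ((N : ℝ≥0∞)⁻¹ • ∑ i, Measure.dirac (z i)) :=
  ⟨by simp [ENNReal.inv_mul_cancel, hN]⟩

lemma isP2_empMeas (hN : N ≠ 0) (x : Fin N → Ed d) : IsP2 (empMeas x) := by
  refine ⟨isProbabilityMeasure_inv_smul_sum_dirac hN x, ?_⟩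
  refine Integrable.smul_measure ?_ (by simp [hN])
  rw [integrable_finsetSum_measure]
  exact fun i _ => integrable_dirac (by simp)

lemma empMeas_comp_perm (y : Fin N → Ed d) (σ : Equiv.Perm (Fin N)) :
    empMeas (fun i => y (σ i)) = empMeas y := by
  unfold empMeas
  rw [Equiv.sum_comp σ fun i => Measure.dirac (y i)]

lemma ae_empMeas {x : Fin N → Ed d} {p : Ed d → Prop} (h : ∀ i, p (x i)) :
    ∀ᵐ a ∂empMeas x, p a := by
  refine Measure.ae_smul_measure ?_ _
  rw [← Measure.sum_fintype, Measure.ae_sum_iff]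
  intro i
  simp [ae_dirac_eq, h]

/-- Pairing the particles by their indices is an admissible transport plan. -/
lemma d2sq_empMeas_le (hN : N ≠ 0) (x y : Fin N → Ed d) :
    d2sq (empMeas x) (empMeas y)
      ≤ (N : ℝ≥0∞)⁻¹ * ∑ i, (‖x i - y i‖₊ : ℝ≥0∞) ^ 2 := by
  have hπ : IsCoupling ((N : ℝ≥0∞)⁻¹ • ∑ i, Measure.dirac (x i, y i))
      (empMeas x) (empMeas y) := by
    refine ⟨isProbabilityMeasure_inv_smul_sum_dirac hN _, ?_, ?_⟩
    · rw [Measure.map_smul, Measure.map_finset_sum measurable_fst.aemeasurable]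
      simp [empMeas, Measure.map_dirac' measurable_fst]
    · rw [Measure.map_smul, Measure.map_finset_sum measurable_snd.aemeasurable]
      simp [empMeas, Measure.map_dirac' measurable_snd]
  calc d2sq (empMeas x) (empMeas y)
      ≤ ∫⁻ p, (‖p.1 - p.2‖₊ : ℝ≥0∞) ^ 2 ∂((N : ℝ≥0∞)⁻¹ • ∑ i, Measure.dirac (x i, y i)) :=
        iInf_le_of_le _ (iInf_le _ hπ)
    _ = (N : ℝ≥0∞)⁻¹ * ∑ i, (‖x i - y i‖₊ : ℝ≥0∞) ^ 2 := by
        simp [lintegral_smul_measure, lintegral_finsetSum_measure]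

/-- The share of the `i`-th particle in an atom of the empirical measure of `x`. -/
def particleShare (x : Fin N → Ed d) (i : Fin N) : Ed d → ℝ≥0∞ :=
  ({x i} : Set (Ed d)).indicator fun _ => ((Finset.univ.filter fun j => x j = x i).card : ℝ≥0∞)⁻¹

lemma measurable_particleShare (x : Fin N → Ed d) (i : Fin N) :
    Measurable (particleShare x i) :=
  measurable_const.indicator (measurableSet_singleton _)

lemma particleShare_apply (x : Fin N → Ed d) (i : Fin N) (a : Ed d) :
    particleShare x i a
      = if x i = a then ((Finset.univ.filter fun j => x j = a).card : ℝ≥0∞)⁻¹ else 0 := by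
  by_cases h : x i = a
  · subst h; simp [particleShare]
  · simp [particleShare, h, Ne.symm h]

lemma particleShare_symm (x : Fin N → Ed d) (i j : Fin N) :
    particleShare x i (x j) = particleShare x j (x i) := by
  simp only [particleShare_apply]
  by_cases h : x i = x j
  · simp [h]
  · simp [h, Ne.symm h]

lemma sum_particleShare (x : Fin N → Ed d) (i : Fin N) :
    ∑ j, particleShare x j (x i) = 1 := by
  have hne : (Finset.univ.filter fun j => x j = x i).card ≠ 0 :=
    Finset.card_ne_zero_of_mem (a := i) (by simp)
  simp_rw [particleShare_apply]
  rw [← Finset.sum_filter, Finset.sum_const, nsmul_eq_mul]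
  exact ENNReal.mul_inv_cancel (by exact_mod_cast hne) (by simp)

lemma lintegral_particleShare (x : Fin N → Ed d) (i : Fin N) :
    ∫⁻ a, particleShare x i a ∂empMeas x = (N : ℝ≥0∞)⁻¹ := by
  simp_rw [lintegral_empMeas, particleShare_symm x i, sum_particleShare, mul_one]

/-- The mass moved from the `i`-th to the `j`-th particle by a coupling of empirical measures. -/
def particleMass (π : Measure (Ed d × Ed d)) (x y : Fin N → Ed d) (i j : Fin N) : ℝ≥0∞ :=
  ∫⁻ p, particleShare x i p.1 * particleShare y j p.2 ∂π

lemma measurable_particleShare_mul (x y : Fin N → Ed d) (i j : Fin N) :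
    Measurable fun p : Ed d × Ed d => particleShare x i p.1 * particleShare y j p.2 :=
  ((measurable_particleShare x i).comp measurable_fst).mul
    ((measurable_particleShare y j).comp measurable_snd)

section coupling

variable {π : Measure (Ed d × Ed d)} {x y : Fin N → Ed d}

lemma ae_sum_particleShare_fst (hπ : π.map Prod.fst = empMeas x) :
    ∀ᵐ p ∂π, ∑ i, particleShare x i p.1 = 1 :=
  ae_of_ae_map (p := fun a => ∑ i, particleShare x i a = 1) measurable_fst.aemeasurable
    (hπ ▸ ae_empMeas (sum_particleShare x))

lemma ae_sum_particleShare_snd (hπ : π.map Prod.snd = empMeas y) :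
    ∀ᵐ p ∂π, ∑ j, particleShare y j p.2 = 1 :=
  ae_of_ae_map (p := fun a => ∑ i, particleShare y i a = 1) measurable_snd.aemeasurable
    (hπ ▸ ae_empMeas (sum_particleShare y))

lemma sum_particleMass_right (hπ : IsCoupling π (empMeas x) (empMeas y)) (i : Fin N) :
    ∑ j, particleMass π x y i j = (N : ℝ≥0∞)⁻¹ := by
  unfold particleMass
  rw [← lintegral_finsetSum _ fun j _ => measurable_particleShare_mul x y i j]
  rw [← lintegral_particleShare x i, ← hπ.2.1,
    lintegral_map (measurable_particleShare x i) measurable_fst]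
  refine lintegral_congr_ae ?_
  filter_upwards [ae_sum_particleShare_snd hπ.2.2] with p hp
  rw [← Finset.mul_sum, hp, mul_one]

lemma sum_particleMass_left (hπ : IsCoupling π (empMeas x) (empMeas y)) (j : Fin N) :
    ∑ i, particleMass π x y i j = (N : ℝ≥0∞)⁻¹ := by
  unfold particleMass
  rw [← lintegral_finsetSum _ fun i _ => measurable_particleShare_mul x y i j]
  rw [← lintegral_particleShare y j, ← hπ.2.2,
    lintegral_map (measurable_particleShare y j) measurable_snd]
  refine lintegral_congr_ae ?_
  filter_upwards [ae_sum_particleShare_fst hπ.2.1] with p hp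
  rw [← Finset.sum_mul, hp, one_mul]

lemma particleMass_ne_top (hN : N ≠ 0) (hπ : IsCoupling π (empMeas x) (empMeas y))
    (i j : Fin N) : particleMass π x y i j ≠ ∞ := by
  refine ne_top_of_le_ne_top (b := (N : ℝ≥0∞)⁻¹) (by simp [hN]) ?_
  rw [← sum_particleMass_right hπ i]
  exact Finset.single_le_sum (f := fun j => particleMass π x y i j) (fun _ _ => zero_le)
    (Finset.mem_univ j)

lemma particleMass_mem_doublyStochastic (hN : N ≠ 0)
    (hπ : IsCoupling π (empMeas x) (empMeas y)) :
    (Matrix.of fun i j => (N : ℝ) * (particleMass π x y i j).toReal)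
      ∈ doublyStochastic ℝ (Fin N) := by
  have hN' : (N : ℝ) ≠ 0 := by exact_mod_cast hN
  refine mem_doublyStochastic_iff_sum.2 ⟨fun i j => by simp; positivity, fun i => ?_, fun j => ?_⟩
  · simp_rw [Matrix.of_apply]
    rw [← Finset.mul_sum, ← ENNReal.toReal_sum fun j _ => particleMass_ne_top hN hπ i j,
      sum_particleMass_right hπ]
    simp [hN']
  · simp_rw [Matrix.of_apply]
    rw [← Finset.mul_sum, ← ENNReal.toReal_sum fun i _ => particleMass_ne_top hN hπ i j,
      sum_particleMass_left hπ]
    simp [hN']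

lemma sum_mul_particleMass_eq_lintegral (hπ : IsCoupling π (empMeas x) (empMeas y)) :
    ∑ i, ∑ j, (‖x i - y j‖₊ : ℝ≥0∞) ^ 2 * particleMass π x y i j
      = ∫⁻ p, (‖p.1 - p.2‖₊ : ℝ≥0∞) ^ 2 ∂π := by
  have hmeas : ∀ i j, Measurable fun p : Ed d × Ed d =>
      (‖x i - y j‖₊ : ℝ≥0∞) ^ 2 * (particleShare x i p.1 * particleShare y j p.2) := fun i j =>
    (measurable_particleShare_mul x y i j).const_mul _
  simp_rw [particleMass, ← lintegral_const_mul _ (measurable_particleShare_mul x y _ _)]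
  have hrow : ∀ i, _ := fun i => lintegral_finsetSum (μ := π) Finset.univ fun j _ => hmeas i j
  simp_rw [← hrow]
  rw [← lintegral_finsetSum _ fun i _ => Finset.measurable_fun_sum _ fun j _ => hmeas i j]
  refine lintegral_congr_ae ?_
  filter_upwards [ae_sum_particleShare_fst hπ.2.1, ae_sum_particleShare_snd hπ.2.2] with p hp hq
  have hterm : ∀ i j,
      (‖x i - y j‖₊ : ℝ≥0∞) ^ 2 * (particleShare x i p.1 * particleShare y j p.2)
        = (‖p.1 - p.2‖₊ : ℝ≥0∞) ^ 2 * (particleShare x i p.1 * particleShare y j p.2) := by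
    intro i j
    by_cases h : x i = p.1
    · by_cases h' : y j = p.2
      · rw [h, h']
      · simp [particleShare_apply y, h']
    · simp [particleShare_apply x, h]
  simp_rw [hterm, ← Finset.mul_sum, hq, mul_one, hp, mul_one]

end coupling

/-- The optimal transport between empirical measures is at least as costly as the best
matching of the particles. -/
lemma exists_perm_le_d2sq_empMeas (hN : N ≠ 0) (x y : Fin N → Ed d) :
    ∃ σ : Equiv.Perm (Fin N),
      ENNReal.ofReal ((N : ℝ)⁻¹ * ∑ i, ‖x i - y (σ i)‖ ^ 2) ≤ d2sq (empMeas x) (empMeas y) := by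
  obtain ⟨σ, hσ⟩ := exists_perm_sum_le_of_mem_doublyStochastic fun i j => ‖x i - y j‖ ^ 2
  refine ⟨σ, le_iInf₂ fun π hπ => ?_⟩
  have hN' : (0 : ℝ) < N := by exact_mod_cast Nat.pos_of_ne_zero hN
  calc ENNReal.ofReal ((N : ℝ)⁻¹ * ∑ i, ‖x i - y (σ i)‖ ^ 2)
      ≤ ENNReal.ofReal (∑ i, ∑ j, ‖x i - y j‖ ^ 2 * (particleMass π x y i j).toReal) := by
        refine ENNReal.ofReal_le_ofReal ?_
        rw [inv_mul_le_iff₀ hN', Finset.mul_sum]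
        refine (hσ _ (particleMass_mem_doublyStochastic hN hπ)).trans_eq ?_
        refine Finset.sum_congr rfl fun i _ => ?_
        rw [Finset.mul_sum]
        exact Finset.sum_congr rfl fun j _ => by rw [Matrix.of_apply]; ring
    _ = ∑ i, ∑ j, (‖x i - y j‖₊ : ℝ≥0∞) ^ 2 * particleMass π x y i j := by
        rw [ENNReal.ofReal_sum_of_nonneg fun i _ => by positivity]
        refine Finset.sum_congr rfl fun i _ => ?_
        rw [ENNReal.ofReal_sum_of_nonneg fun i _ => by positivity]
        refine Finset.sum_congr rfl fun j _ => ?_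
        rw [ENNReal.ofReal_mul (by positivity),
          ENNReal.ofReal_toReal (particleMass_ne_top hN hπ i j),
          ENNReal.ofReal_pow (norm_nonneg _), ofReal_norm, enorm_eq_nnnorm]
    _ = ∫⁻ p, (‖p.1 - p.2‖₊ : ℝ≥0∞) ^ 2 ∂π := sum_mul_particleMass_eq_lintegral hπ

lemma toReal_inv_mul_sum_nnnorm_sq (x y : Fin N → Ed d) :
    ((N : ℝ≥0∞)⁻¹ * ∑ i, (‖x i - y i‖₊ : ℝ≥0∞) ^ 2).toReal
      = (N : ℝ)⁻¹ * ∑ i, ‖x i - y i‖ ^ 2 := by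
  rw [ENNReal.toReal_mul, ENNReal.toReal_sum fun i _ => by simp]
  simp

lemma inv_mul_sum_nnnorm_sq_ne_top (hN : N ≠ 0) (x y : Fin N → Ed d) :
    (N : ℝ≥0∞)⁻¹ * ∑ i, (‖x i - y i‖₊ : ℝ≥0∞) ^ 2 ≠ ∞ :=
  ENNReal.mul_ne_top (by simp [hN]) (ENNReal.sum_ne_top.2 fun i _ => by simp)

lemma toReal_d2sq_empMeas_le (hN : N ≠ 0) (x y : Fin N → Ed d) :
    (d2sq (empMeas x) (empMeas y)).toReal ≤ (N : ℝ)⁻¹ * ∑ i, ‖x i - y i‖ ^ 2 := by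
  rw [← toReal_inv_mul_sum_nnnorm_sq]
  exact ENNReal.toReal_mono (inv_mul_sum_nnnorm_sq_ne_top hN x y) (d2sq_empMeas_le hN x y)

lemma exists_perm_le_toReal_d2sq_empMeas (hN : N ≠ 0) (x y : Fin N → Ed d) :
    ∃ σ : Equiv.Perm (Fin N),
      (N : ℝ)⁻¹ * ∑ i, ‖x i - y (σ i)‖ ^ 2 ≤ (d2sq (empMeas x) (empMeas y)).toReal := by
  obtain ⟨σ, hσ⟩ := exists_perm_le_d2sq_empMeas hN x y
  exact ⟨σ, (ENNReal.ofReal_le_iff_le_toReal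
    (ne_top_of_le_ne_top (inv_mul_sum_nnnorm_sq_ne_top hN x y) (d2sq_empMeas_le hN x y))).1 hσ⟩

end empMeas

/-- in the Hopf–Lax formula for `V^N` the normalized sum of squared
coordinate distances may be replaced by the squared 2-Wasserstein distance between the
empirical measures. -/
theorem nParticle_hopfLax_wasserstein {d N : ℕ} (hd : 1 ≤ d) (hN : 1 ≤ N)
    (T : ℝ) (hT : 0 < T)
    (G : Measure (Ed d) → ℝ)
    (hGbd : ∃ c : ℝ, ∀ μ : Measure (Ed d), IsP2 μ → c ≤ G μ)
    (t : ℝ) (ht : 0 ≤ t) (htT : t < T) (x : Fin N → Ed d) :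
    NPval T G t x
      = sInf { r : ℝ | ∃ y : Fin N → Ed d,
          r = G (empMeas y) + (d2sq (empMeas x) (empMeas y)).toReal / (2 * (T - t)) } := by
  have hN0 : N ≠ 0 := by omega
  have hs : 0 < T - t := sub_pos.2 htT
  obtain ⟨c, hc⟩ := hGbd
  have hcost : ∀ y : Fin N → Ed d, (1 / (2 * (T - t) * (N : ℝ))) * ∑ i, ‖x i - y i‖ ^ 2
      = ((N : ℝ)⁻¹ * ∑ i, ‖x i - y i‖ ^ 2) / (2 * (T - t)) := fun y => by
    field_simp
  unfold NPval
  simp_rw [hcost]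
  apply le_antisymm
  · have hbdd : BddBelow {r : ℝ | ∃ y : Fin N → Ed d,
        r = G (empMeas y) + ((N : ℝ)⁻¹ * ∑ i, ‖x i - y i‖ ^ 2) / (2 * (T - t))} := by
      refine ⟨c, ?_⟩
      rintro _ ⟨z, rfl⟩
      exact le_add_of_le_of_nonneg (hc _ (isP2_empMeas hN0 z)) (by positivity)
    refine le_csInf ⟨_, x, rfl⟩ ?_
    rintro _ ⟨y, rfl⟩
    obtain ⟨σ, hσ⟩ := exists_perm_le_toReal_d2sq_empMeas hN0 x y
    refine (csInf_le hbdd ⟨fun i => y (σ i), rfl⟩).trans ?_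
    rw [empMeas_comp_perm]
    gcongr
  · have hbdd : BddBelow {r : ℝ | ∃ y : Fin N → Ed d,
        r = G (empMeas y) + (d2sq (empMeas x) (empMeas y)).toReal / (2 * (T - t))} := by
      refine ⟨c, ?_⟩
      rintro _ ⟨z, rfl⟩
      exact le_add_of_le_of_nonneg (hc _ (isP2_empMeas hN0 z)) (by positivity)
    refine le_csInf ⟨_, x, rfl⟩ ?_
    rintro _ ⟨y, rfl⟩
    refine (csInf_le hbdd ⟨y, rfl⟩).trans ?_
    gcongr
    exact toReal_d2sq_empMeas_le hN0 x y

end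
end

section
/- Let d, N ≥ 1, T > 0, and let G : P_2(ℝ^d) → ℝ be Lipschitz continuous with respect to d_1 with constant L_G. Fix t ∈ [0,T) and x ∈ (ℝ^d)^N, and let ν̄ ∈ P_2(ℝ^d) be any minimizer, i.e. G(ν̄) + d_2(m_x^N, ν̄)²/(2(T−t)) = U(t, m_x^N). Then for every p ≥ 5, ν̄ has finite p-th moment and M_p(ν̄) ≤ L_G (T−t) + M_p(m_x^N), where M_p(ν) := (∫_{ℝ^d} |x|^p dν(x))^{1/p}. -/
open MeasureTheory Filter
open scoped ENNReal NNReal BigOperators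

noncomputable section

/-- The `p`-th moment `M_p(ν) = (∫ |x|^p dν)^{1/p}`. -/
def Mp {d : ℕ} (p : ℝ) (ν : Measure (Ed d)) : ℝ := (∫ x, ‖x‖ ^ p ∂ν) ^ (1 / p)

/-- Radial projection of `v` onto the closed ball of radius `R`. -/
def radialTrunc {d : ℕ} (R : ℝ) (v : Ed d) : Ed d := (min 1 (R / ‖v‖)) • v

lemma norm_radialTrunc {d : ℕ} {R : ℝ} (hR : 0 ≤ R) (v : Ed d) :
    ‖radialTrunc R v‖ = min ‖v‖ R := by
  rcases eq_or_ne v 0 with rfl | hv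
  · simp [radialTrunc, hR]
  · have hv' : 0 < ‖v‖ := norm_pos_iff.2 hv
    have h0 : 0 ≤ min 1 (R / ‖v‖) := le_min zero_le_one (by positivity)
    rw [radialTrunc, norm_smul, Real.norm_of_nonneg h0, min_mul_of_nonneg _ _ hv'.le, one_mul,
      div_mul_cancel₀ _ hv'.ne']

lemma norm_sub_radialTrunc {d : ℕ} {R : ℝ} (hR : 0 ≤ R) (v : Ed d) :
    ‖v - radialTrunc R v‖ = ‖v‖ - min ‖v‖ R := by
  rcases eq_or_ne v 0 with rfl | hv
  · simp [radialTrunc, hR]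
  · have hv' : 0 < ‖v‖ := norm_pos_iff.2 hv
    have h0 : 0 ≤ 1 - min 1 (R / ‖v‖) := sub_nonneg.2 (min_le_left _ _)
    have : v - radialTrunc R v = (1 - min 1 (R / ‖v‖)) • v := by
      rw [radialTrunc, sub_smul, one_smul]
    rw [this, norm_smul, Real.norm_of_nonneg h0, sub_mul, min_mul_of_nonneg _ _ hv'.le, one_mul,
      div_mul_cancel₀ _ hv'.ne']

lemma measurable_radialTrunc {d : ℕ} (R : ℝ) : Measurable (radialTrunc (d := d) R) := by
  unfold radialTrunc
  exact (measurable_const.min (measurable_const.div measurable_norm)).smul measurable_id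

lemma IsP2.memLp {d : ℕ} {μ : Measure (Ed d)} (h : IsP2 μ) : MemLp id 2 μ :=
  (memLp_two_iff_integrable_sq_norm aestronglyMeasurable_id).2 h.2

lemma isP2_map {d : ℕ} {Ω : Type*} [MeasurableSpace Ω] {P : Measure Ω} [IsProbabilityMeasure P]
    {X : Ω → Ed d} (hX : Measurable X) (h : MemLp X 2 P) : IsP2 (P.map X) :=
  ⟨Measure.isProbabilityMeasure_map hX.aemeasurable,
    (memLp_two_iff_integrable_sq_norm aestronglyMeasurable_id).1
      ((memLp_map_measure_iff aestronglyMeasurable_id hX.aemeasurable).2 h)⟩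

lemma isP2_of_ae_bound {d : ℕ} {μ : Measure (Ed d)} [IsProbabilityMeasure μ] {C : ℝ}
    (h : ∀ᵐ x ∂μ, ‖x‖ ≤ C) : IsP2 μ :=
  ⟨inferInstance, (memLp_two_iff_integrable_sq_norm aestronglyMeasurable_id).1
    (MemLp.of_bound aestronglyMeasurable_id C h)⟩

lemma integral_sub_le_of_lipschitz {d : ℕ} {Ω : Type*} [MeasurableSpace Ω] {P : Measure Ω}
    [IsProbabilityMeasure P] {X Y : Ω → Ed d} (hX : Measurable X) (hY : Measurable Y)
    (hX1 : Integrable X P) (hY1 : Integrable Y P) {f : Ed d → ℝ} (hf : LipschitzWith 1 f) :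
    (∫ x, f x ∂P.map X) - ∫ x, f x ∂P.map Y ≤ ∫ ω, ‖X ω - Y ω‖ ∂P := by
  have hint : ∀ {Z : Ω → Ed d}, Measurable Z → Integrable Z P →
      Integrable (fun ω => f (Z ω)) P := by
    intro Z hZ hZ1
    refine (hZ1.norm.add (integrable_const |f 0|)).mono'
      (hf.continuous.measurable.comp hZ).aestronglyMeasurable (ae_of_all _ fun ω => ?_)
    have h1 := hf.dist_le_mul (Z ω) 0
    simp only [Real.dist_eq, NNReal.coe_one, one_mul, dist_zero_right] at h1
    have h2 := abs_sub_abs_le_abs_sub (f (Z ω)) (f 0)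
    simp only [Real.norm_eq_abs, Pi.add_apply]
    linarith
  rw [integral_map hX.aemeasurable hf.continuous.aestronglyMeasurable,
    integral_map hY.aemeasurable hf.continuous.aestronglyMeasurable,
    ← integral_sub (hint hX hX1) (hint hY hY1)]
  refine integral_mono ((hint hX hX1).sub (hint hY hY1)) (hX1.sub hY1).norm fun ω => ?_
  have h1 := hf.dist_le_mul (X ω) (Y ω)
  simp only [NNReal.coe_one, one_mul, dist_eq_norm] at h1
  exact (le_abs_self _).trans h1

lemma d1_map_le {d : ℕ} {Ω : Type*} [MeasurableSpace Ω] {P : Measure Ω}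
    [IsProbabilityMeasure P] {X Y : Ω → Ed d} (hX : Measurable X) (hY : Measurable Y)
    (hX1 : Integrable X P) (hY1 : Integrable Y P) :
    d1 (P.map X) (P.map Y) ≤ ∫ ω, ‖X ω - Y ω‖ ∂P := by
  refine csSup_le ⟨0, fun _ => 0, LipschitzWith.const' 0, by simp⟩ ?_
  rintro r ⟨f, hf, rfl⟩
  exact integral_sub_le_of_lipschitz hX hY hX1 hY1 hf

lemma lintegral_sq_eq {d : ℕ} {Ω : Type*} [MeasurableSpace Ω] {P : Measure Ω} {V : Ω → Ed d}
    (hV : MemLp V 2 P) :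
    ∫⁻ ω, (‖V ω‖₊ : ℝ≥0∞) ^ 2 ∂P = ENNReal.ofReal (∫ ω, ‖V ω‖ ^ 2 ∂P) := by
  rw [ofReal_integral_eq_lintegral_ofReal hV.norm.integrable_sq
    (ae_of_all _ fun ω => by positivity)]
  refine lintegral_congr fun ω => ?_
  rw [ENNReal.ofReal_pow (norm_nonneg _), ofReal_norm]
  rfl

lemma d2sq_map_le {d : ℕ} {Ω : Type*} [MeasurableSpace Ω] {P : Measure Ω}
    [IsProbabilityMeasure P] {X Y : Ω → Ed d} (hX : Measurable X) (hY : Measurable Y)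
    (hX2 : MemLp X 2 P) (hY2 : MemLp Y 2 P) :
    d2sq (P.map X) (P.map Y) ≤ ENNReal.ofReal (∫ ω, ‖X ω - Y ω‖ ^ 2 ∂P) := by
  have hXY : Measurable fun ω => (X ω, Y ω) := hX.prodMk hY
  have hc : IsCoupling (P.map fun ω => (X ω, Y ω)) (P.map X) (P.map Y) :=
    ⟨Measure.isProbabilityMeasure_map hXY.aemeasurable, by
      rw [Measure.map_map measurable_fst hXY]; rfl, by
      rw [Measure.map_map measurable_snd hXY]; rfl⟩
  refine iInf₂_le_of_le _ hc ?_
  rw [lintegral_map (by fun_prop) hXY]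
  exact (lintegral_sq_eq (hX2.sub hY2)).le

lemma IsCoupling.memLp {d : ℕ} {μ ν : Measure (Ed d)} {π : Measure (Ed d × Ed d)}
    (h : IsCoupling π μ ν) (hμ : IsP2 μ) (hν : IsP2 ν) :
    MemLp (fun p : Ed d × Ed d => p.1) 2 π ∧ MemLp (fun p : Ed d × Ed d => p.2) 2 π := by
  obtain ⟨_, rfl, rfl⟩ := h
  exact ⟨(memLp_map_measure_iff aestronglyMeasurable_id measurable_fst.aemeasurable).1 hμ.memLp,
    (memLp_map_measure_iff aestronglyMeasurable_id measurable_snd.aemeasurable).1 hν.memLp⟩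

lemma d2sq_ne_top {d : ℕ} {μ ν : Measure (Ed d)} (hμ : IsP2 μ) (hν : IsP2 ν) :
    d2sq μ ν ≠ ⊤ := by
  have := hμ.1
  have := hν.1
  have hc : IsCoupling (μ.prod ν) μ ν := ⟨inferInstance, by simp, by simp⟩
  obtain ⟨h1, h2⟩ := hc.memLp hμ hν
  have h := d2sq_map_le measurable_fst measurable_snd h1 h2
  rw [hc.2.1, hc.2.2] at h
  exact ne_top_of_le_ne_top ENNReal.ofReal_ne_top h

lemma exists_coupling_integral_le {d : ℕ} {μ ν : Measure (Ed d)} (hμ : IsP2 μ) (hν : IsP2 ν)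
    {ε : ℝ} (hε : 0 < ε) :
    ∃ π, IsCoupling π μ ν ∧ ∫ p, ‖p.1 - p.2‖ ^ 2 ∂π ≤ (d2sq μ ν).toReal + ε := by
  have hfin := d2sq_ne_top hμ hν
  have hlt : d2sq μ ν < d2sq μ ν + ENNReal.ofReal ε :=
    ENNReal.lt_add_right hfin (by simpa using hε)
  obtain ⟨π, hlt⟩ := iInf_lt_iff.1 hlt
  obtain ⟨hπ, hlt⟩ := iInf_lt_iff.1 hlt
  obtain ⟨h1, h2⟩ := hπ.memLp hμ hν
  refine ⟨π, hπ, ?_⟩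
  have h := lintegral_sq_eq (h1.sub h2)
  simp only [Pi.sub_apply] at h
  rw [h, ← ENNReal.ofReal_toReal hfin, ← ENNReal.ofReal_add ENNReal.toReal_nonneg hε.le] at hlt
  exact (ENNReal.ofReal_le_ofReal_iff (by positivity)).1 hlt.le

lemma lipschitz_const_nonneg {d : ℕ} (hd : 1 ≤ d) {G : Measure (Ed d) → ℝ} {LG : ℝ}
    (hG : ∀ μ ν : Measure (Ed d), IsP2 μ → IsP2 ν → |G μ - G ν| ≤ LG * d1 μ ν) : 0 ≤ LG := by
  let e : Ed d := EuclideanSpace.single ⟨0, hd⟩ 1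
  have he : ‖e‖ = 1 := by simp [e]
  have hP : ∀ a : Ed d, IsP2 (Measure.dirac a) := fun a =>
    isP2_of_ae_bound (C := ‖a‖) (by simp [ae_dirac_eq])
  have hpos : 1 ≤ d1 (Measure.dirac e) (Measure.dirac (0 : Ed d)) := by
    refine le_csSup ⟨1, ?_⟩ ⟨fun x => ‖x‖, lipschitzWith_one_norm, by simp [he]⟩
    rintro r ⟨f, hf, rfl⟩
    have h1 := hf.dist_le_mul e 0
    simp only [Real.dist_eq, NNReal.coe_one, one_mul, dist_zero_right, he] at h1
    simpa using (le_abs_self _).trans h1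
  have h := (abs_nonneg _).trans (hG _ _ (hP e) (hP 0))
  by_contra! hneg
  nlinarith

lemma bddBelow_hopfLax {d : ℕ} {G : Measure (Ed d) → ℝ} {L τ : ℝ} (hL : 0 ≤ L) (hτ : 0 < τ)
    (hG : ∀ μ ν : Measure (Ed d), IsP2 μ → IsP2 ν → |G μ - G ν| ≤ L * d1 μ ν)
    {m : Measure (Ed d)} (hm : IsP2 m) :
    BddBelow {r | ∃ ν : Measure (Ed d), IsP2 ν ∧ r = G ν + (d2sq m ν).toReal / (2 * τ)} := by
  refine ⟨G m - L ^ 2 * τ / 2 - 1 / (2 * τ), ?_⟩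
  rintro r ⟨ν, hν, rfl⟩
  obtain ⟨π, hπ, hle⟩ := exists_coupling_integral_le hm hν one_pos
  obtain ⟨h1, h2⟩ := hπ.memLp hm hν
  have := hπ.1
  have hd1 := d1_map_le measurable_fst measurable_snd (h1.integrable one_le_two)
    (h2.integrable one_le_two)
  rw [hπ.2.1, hπ.2.2] at hd1
  have hsq : Integrable (fun p : Ed d × Ed d => ‖p.1 - p.2‖ ^ 2) π :=
    (h1.sub h2).norm.integrable_sq
  have hn : Integrable (fun p : Ed d × Ed d => ‖p.1 - p.2‖) π :=
    ((h1.sub h2).integrable one_le_two).norm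
  have hy : L * ∫ p, ‖p.1 - p.2‖ ∂π ≤ L ^ 2 * τ / 2 + (∫ p, ‖p.1 - p.2‖ ^ 2 ∂π) / (2 * τ) := by
    rw [← integral_const_mul, ← integral_div]
    have hc : L ^ 2 * τ / 2 = ∫ _, L ^ 2 * τ / 2 ∂π := by simp
    rw [hc, ← integral_add (integrable_const _) (hsq.div_const _)]
    refine integral_mono (hn.const_mul _) ((integrable_const _).add (hsq.div_const _)) fun p => ?_
    have : L ^ 2 * τ / 2 + ‖p.1 - p.2‖ ^ 2 / (2 * τ) - L * ‖p.1 - p.2‖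
        = (L * τ - ‖p.1 - p.2‖) ^ 2 / (2 * τ) := by
      field_simp
      ring
    have h0 : 0 ≤ (L * τ - ‖p.1 - p.2‖) ^ 2 / (2 * τ) := by positivity
    simp only
    linarith
  have hGm := (le_abs_self _).trans (hG m ν hm hν)
  have hLd := mul_le_mul_of_nonneg_left hd1 hL
  have hdiv : (∫ p, ‖p.1 - p.2‖ ^ 2 ∂π) / (2 * τ)
      ≤ (d2sq m ν).toReal / (2 * τ) + 1 / (2 * τ) := by
    rw [← add_div]
    gcongr
  linarith

/-- Along almost optimal couplings, a minimizer of the Hopf–Lax problem is transported by at most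
`L * τ`, up to a small error in `L²`. -/
lemma exists_coupling_excess_le {d : ℕ} {G : Measure (Ed d) → ℝ} {L τ : ℝ} (hL : 0 ≤ L)
    (hτ : 0 < τ)
    (hG : ∀ μ ν : Measure (Ed d), IsP2 μ → IsP2 ν → |G μ - G ν| ≤ L * d1 μ ν)
    {m νb : Measure (Ed d)} (hm : IsP2 m) (hνb : IsP2 νb)
    (hmin : ∀ ν, IsP2 ν →
      G νb + (d2sq m νb).toReal / (2 * τ) ≤ G ν + (d2sq m ν).toReal / (2 * τ))
    {ε : ℝ} (hε : 0 < ε) :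
    ∃ π, IsCoupling π m νb ∧
      ∫ p, ‖(p.2 - p.1) - radialTrunc (L * τ) (p.2 - p.1)‖ ^ 2 ∂π ≤ ε := by
  have hR : 0 ≤ L * τ := by positivity
  set R := L * τ with hRdef
  obtain ⟨π, hπ, hle⟩ := exists_coupling_integral_le hm hνb hε
  obtain ⟨h1, h2⟩ := hπ.memLp hm hνb
  have := hπ.1
  refine ⟨π, hπ, ?_⟩
  have hV : MemLp (fun p : Ed d × Ed d => p.2 - p.1) 2 π := h2.sub h1
  have hWm : Measurable fun p : Ed d × Ed d => radialTrunc R (p.2 - p.1) :=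
    (measurable_radialTrunc R).comp (measurable_snd.sub measurable_fst)
  have hW : MemLp (fun p : Ed d × Ed d => radialTrunc R (p.2 - p.1)) 2 π :=
    hV.mono hWm.aestronglyMeasurable
      (ae_of_all _ fun p => by rw [norm_radialTrunc hR]; exact min_le_left _ _)
  have hZm : Measurable fun p : Ed d × Ed d => p.1 + radialTrunc R (p.2 - p.1) :=
    measurable_fst.add hWm
  have hZ : MemLp (fun p : Ed d × Ed d => p.1 + radialTrunc R (p.2 - p.1)) 2 π := h1.add hW
  have hν' := isP2_map hZm hZ
  have hopt := hmin _ hν'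
  have hGl' := (le_abs_self _).trans (hG _ νb hν' hνb)
  have hd1 := d1_map_le hZm measurable_snd (hZ.integrable one_le_two) (h2.integrable one_le_two)
  rw [hπ.2.2] at hd1
  have hd2 := ENNReal.toReal_mono ENNReal.ofReal_ne_top (d2sq_map_le measurable_fst hZm h1 hZ)
  rw [hπ.2.1, ENNReal.toReal_ofReal (by positivity)] at hd2
  have e1 : ∀ p : Ed d × Ed d, ‖p.1 + radialTrunc R (p.2 - p.1) - p.2‖
      = ‖(p.2 - p.1) - radialTrunc R (p.2 - p.1)‖ := fun p => by
    rw [← norm_neg]; congr 1; abel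
  have e2 : ∀ p : Ed d × Ed d, ‖p.1 - (p.1 + radialTrunc R (p.2 - p.1))‖
      = ‖radialTrunc R (p.2 - p.1)‖ := fun p => by
    rw [← norm_neg]; congr 1; abel
  have e3 : ∀ p : Ed d × Ed d, ‖p.1 - p.2‖ = ‖p.2 - p.1‖ := fun p => norm_sub_rev _ _
  simp only [e1] at hd1
  simp only [e2] at hd2
  simp only [e3] at hle
  have i1 := hV.norm.integrable_sq
  have i2 := hW.norm.integrable_sq
  have i3 := ((hV.sub hW).integrable one_le_two).norm
  simp only [Pi.sub_apply] at i3
  have i12 : Integrable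
      (fun p : Ed d × Ed d => ‖p.2 - p.1‖ ^ 2 - ‖radialTrunc R (p.2 - p.1)‖ ^ 2) π := i1.sub i2
  have key : ∫ p, ‖(p.2 - p.1) - radialTrunc R (p.2 - p.1)‖ ^ 2 ∂π
      = (∫ p, ‖p.2 - p.1‖ ^ 2 ∂π) - (∫ p, ‖radialTrunc R (p.2 - p.1)‖ ^ 2 ∂π)
        - 2 * R * ∫ p, ‖(p.2 - p.1) - radialTrunc R (p.2 - p.1)‖ ∂π := by
    rw [← integral_const_mul, ← integral_sub i1 i2, ← integral_sub i12 (i3.const_mul _)]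
    refine integral_congr_ae (ae_of_all _ fun p => ?_)
    simp only [norm_sub_radialTrunc hR, norm_radialTrunc hR]
    rcases le_total ‖p.2 - p.1‖ R with h | h
    · simp [h]
    · rw [min_eq_right h]; ring
  rw [key]
  have hLd := mul_le_mul_of_nonneg_left hd1 hL
  have hfin : (d2sq m νb).toReal / (2 * τ) ≤
      L * (∫ p, ‖(p.2 - p.1) - radialTrunc R (p.2 - p.1)‖ ∂π)
        + (∫ p, ‖radialTrunc R (p.2 - p.1)‖ ^ 2 ∂π) / (2 * τ) := by
    have : (d2sq m (π.map fun p => p.1 + radialTrunc R (p.2 - p.1))).toReal / (2 * τ)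
        ≤ (∫ p, ‖radialTrunc R (p.2 - p.1)‖ ^ 2 ∂π) / (2 * τ) := by gcongr
    linarith
  rw [div_le_iff₀ (by positivity), add_mul, div_mul_cancel₀ _ (by positivity)] at hfin
  rw [hRdef] at hfin ⊢
  linarith

lemma ae_bound_of_excess {d : ℕ} {m ν : Measure (Ed d)} (hm : IsP2 m) (hν : IsP2 ν)
    {C R : ℝ} (hC0 : 0 ≤ C) (hR : 0 ≤ R) (hC : ∀ᵐ x ∂m, ‖x‖ ≤ C)
    (h : ∀ ε : ℝ, 0 < ε → ∃ π, IsCoupling π m ν ∧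
      ∫ p, ‖(p.2 - p.1) - radialTrunc R (p.2 - p.1)‖ ^ 2 ∂π ≤ ε) :
    ∀ᵐ y ∂ν, ‖y‖ ≤ C + R := by
  have := hν.1
  have hcont : Continuous fun y : Ed d => max (‖y‖ - (C + R)) 0 ^ 2 := by fun_prop
  have hle : ∫ y, max (‖y‖ - (C + R)) 0 ^ 2 ∂ν ≤ 0 := by
    refine le_of_forall_pos_le_add fun ε hε => ?_
    obtain ⟨π, hπ, hπε⟩ := h ε hε
    obtain ⟨h1, h2⟩ := hπ.memLp hm hν
    have := hπ.1
    rw [zero_add]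
    refine le_trans ?_ hπε
    have hm1 : ∀ᵐ p ∂π, ‖p.1‖ ≤ C :=
      ae_of_ae_map measurable_fst.aemeasurable (by rw [hπ.2.1]; exact hC)
    rw [← hπ.2.2, integral_map measurable_snd.aemeasurable hcont.aestronglyMeasurable]
    have hV : MemLp (fun p : Ed d × Ed d => p.2 - p.1) 2 π := h2.sub h1
    have hEm : Measurable fun p : Ed d × Ed d => (p.2 - p.1) - radialTrunc R (p.2 - p.1) :=
      (measurable_snd.sub measurable_fst).sub
        ((measurable_radialTrunc R).comp (measurable_snd.sub measurable_fst))
    have hE : MemLp (fun p : Ed d × Ed d => (p.2 - p.1) - radialTrunc R (p.2 - p.1)) 2 π :=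
      hV.mono hEm.aestronglyMeasurable (ae_of_all _ fun p => by
        rw [norm_sub_radialTrunc hR]
        linarith [le_min (norm_nonneg (p.2 - p.1)) hR])
    refine integral_mono_of_nonneg (ae_of_all _ fun p => by positivity)
      hE.norm.integrable_sq ?_
    filter_upwards [hm1] with p hp
    gcongr
    rw [norm_sub_radialTrunc hR]
    refine max_le ?_ (sub_nonneg.2 (min_le_left _ _))
    have := norm_sub_norm_le p.2 p.1
    have := min_le_right ‖p.2 - p.1‖ R
    linarith
  have hint : Integrable (fun y : Ed d => max (‖y‖ - (C + R)) 0 ^ 2) ν := by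
    refine hν.2.mono' hcont.aestronglyMeasurable (ae_of_all _ fun y => ?_)
    rw [Real.norm_of_nonneg (by positivity)]
    gcongr
    exact max_le (by linarith) (norm_nonneg _)
  have hz := (integral_eq_zero_iff_of_nonneg (fun y => by positivity) hint).1
    (le_antisymm hle (integral_nonneg fun y => by positivity))
  filter_upwards [hz] with y hy
  have hy' : max (‖y‖ - (C + R)) 0 = 0 := by simpa using hy
  linarith [le_max_left (‖y‖ - (C + R)) 0]

lemma eLpNorm_id_eq_Mp {d : ℕ} {μ : Measure (Ed d)} {p : ℝ} (hp : 0 < p)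
    (h : MemLp id (ENNReal.ofReal p) μ) :
    eLpNorm id (ENNReal.ofReal p) μ = ENNReal.ofReal (Mp p μ) := by
  rw [h.eLpNorm_eq_integral_rpow_norm (by simpa using hp) ENNReal.ofReal_ne_top, Mp,
    ENNReal.toReal_ofReal hp.le, one_div]
  rfl

lemma Mp_nonneg {d : ℕ} (p : ℝ) (μ : Measure (Ed d)) : 0 ≤ Mp p μ :=
  Real.rpow_nonneg (integral_nonneg fun _ => by positivity) _

/-- Interpolation: smallness in `L²` and boundedness give smallness in `L^p`. -/
lemma eLpNorm_le_of_integral_sq_le {d : ℕ} {Ω : Type*} [MeasurableSpace Ω] {P : Measure Ω}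
    [IsProbabilityMeasure P] {V : Ω → Ed d} (hVm : AEStronglyMeasurable V P) {K δ p : ℝ}
    (hK : 0 < K) (hδ : 0 < δ) (hp : 2 ≤ p) (hb : ∀ᵐ ω ∂P, ‖V ω‖ ≤ K)
    (h2 : ∫ ω, ‖V ω‖ ^ 2 ∂P ≤ δ ^ p / K ^ (p - 2)) :
    eLpNorm V (ENNReal.ofReal p) P ≤ ENNReal.ofReal δ := by
  have hp0 : 0 < p := by linarith
  have hV : ∀ q, MemLp V q P := fun q => MemLp.of_bound hVm K hb
  rw [(hV _).eLpNorm_eq_integral_rpow_norm (by simpa using hp0) ENNReal.ofReal_ne_top,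
    ENNReal.toReal_ofReal hp0.le]
  refine ENNReal.ofReal_le_ofReal ?_
  have hKp : 0 < K ^ (p - 2) := Real.rpow_pos_of_pos hK _
  have hle : ∫ ω, ‖V ω‖ ^ p ∂P ≤ δ ^ p := by
    calc ∫ ω, ‖V ω‖ ^ p ∂P ≤ ∫ ω, K ^ (p - 2) * ‖V ω‖ ^ 2 ∂P := by
          refine integral_mono_of_nonneg (ae_of_all _ fun ω => by positivity)
            ((hV 2).norm.integrable_sq.const_mul _) ?_
          filter_upwards [hb] with ω hω
          have hs : ‖V ω‖ ^ p = ‖V ω‖ ^ (p - 2) * ‖V ω‖ ^ 2 := by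
            rw [← Real.rpow_two, ← Real.rpow_add_of_nonneg (norm_nonneg _) (by linarith)
              (by norm_num)]
            congr 1; ring
          simp only [hs]
          gcongr
      _ = K ^ (p - 2) * ∫ ω, ‖V ω‖ ^ 2 ∂P := integral_const_mul _ _
      _ ≤ K ^ (p - 2) * (δ ^ p / K ^ (p - 2)) := by gcongr
      _ = δ ^ p := mul_div_cancel₀ _ hKp.ne'
  calc (∫ ω, ‖V ω‖ ^ p ∂P) ^ p⁻¹ ≤ (δ ^ p) ^ p⁻¹ :=
        Real.rpow_le_rpow (integral_nonneg fun _ => by positivity) hle (by positivity)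
    _ = δ := Real.rpow_rpow_inv hδ.le hp0.ne'

lemma Mp_le_of_excess {d : ℕ} {m ν : Measure (Ed d)} (hm : IsP2 m) (hν : IsP2 ν)
    {C R p : ℝ} (hC0 : 0 ≤ C) (hR : 0 ≤ R) (hp : 2 ≤ p) (hC : ∀ᵐ x ∂m, ‖x‖ ≤ C)
    (h : ∀ ε : ℝ, 0 < ε → ∃ π, IsCoupling π m ν ∧
      ∫ p, ‖(p.2 - p.1) - radialTrunc R (p.2 - p.1)‖ ^ 2 ∂π ≤ ε) :
    Mp p ν ≤ R + Mp p m := by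
  have hb := ae_bound_of_excess hm hν hC0 hR hC h
  have hp0 : 0 < p := by linarith
  have := hm.1
  have := hν.1
  refine le_of_forall_pos_le_add fun δ hδ => ?_
  have hK : 0 < C + R + C + 1 := by linarith
  obtain ⟨π, hπ, hπε⟩ := h (δ ^ p / (C + R + C + 1) ^ (p - 2)) (by positivity)
  have := hπ.1
  have hfst : eLpNorm (fun q : Ed d × Ed d => q.1) (ENNReal.ofReal p) π
      = ENNReal.ofReal (Mp p m) := by
    rw [← eLpNorm_id_eq_Mp hp0 (MemLp.of_bound aestronglyMeasurable_id C hC), ← hπ.2.1,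
      eLpNorm_map_measure aestronglyMeasurable_id measurable_fst.aemeasurable]
    rfl
  have hsnd : eLpNorm (fun q : Ed d × Ed d => q.2) (ENNReal.ofReal p) π
      = ENNReal.ofReal (Mp p ν) := by
    rw [← eLpNorm_id_eq_Mp hp0 (MemLp.of_bound aestronglyMeasurable_id _ hb), ← hπ.2.2,
      eLpNorm_map_measure aestronglyMeasurable_id measurable_snd.aemeasurable]
    rfl
  have hm1 : ∀ᵐ q ∂π, ‖q.1‖ ≤ C :=
    ae_of_ae_map measurable_fst.aemeasurable (by rw [hπ.2.1]; exact hC)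
  have hm2 : ∀ᵐ q ∂π, ‖q.2‖ ≤ C + R :=
    ae_of_ae_map measurable_snd.aemeasurable (by rw [hπ.2.2]; exact hb)
  have hWm : Measurable fun q : Ed d × Ed d => radialTrunc R (q.2 - q.1) :=
    (measurable_radialTrunc R).comp (measurable_snd.sub measurable_fst)
  have hEm : Measurable fun q : Ed d × Ed d => (q.2 - q.1) - radialTrunc R (q.2 - q.1) :=
    (measurable_snd.sub measurable_fst).sub hWm
  have hE := eLpNorm_le_of_integral_sq_le (P := π) hEm.aestronglyMeasurable hK hδ hp (by
    filter_upwards [hm1, hm2] with q h1 h2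
    rw [norm_sub_radialTrunc hR]
    have := norm_sub_le q.2 q.1
    linarith [le_min (norm_nonneg (q.2 - q.1)) hR]) hπε
  have hW : eLpNorm (fun q : Ed d × Ed d => radialTrunc R (q.2 - q.1)) (ENNReal.ofReal p) π
      ≤ ENNReal.ofReal R := by
    refine (eLpNorm_le_of_ae_bound (C := R) (ae_of_all _ fun q => ?_)).trans (by simp)
    rw [norm_radialTrunc hR]
    exact min_le_right _ _
  have hp1 : 1 ≤ ENNReal.ofReal p := by
    rw [← ENNReal.ofReal_one]; exact ENNReal.ofReal_le_ofReal (by linarith)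
  have hdec : (fun q : Ed d × Ed d => q.2) = (fun q : Ed d × Ed d => radialTrunc R (q.2 - q.1))
      + (fun q => q.1) + fun q => (q.2 - q.1) - radialTrunc R (q.2 - q.1) := by
    funext q
    simp only [Pi.add_apply]
    abel
  have hM := Mp_nonneg p m
  have hfinal : ENNReal.ofReal (Mp p ν) ≤ ENNReal.ofReal (R + Mp p m + δ) := by
    rw [← hsnd, hdec, ENNReal.ofReal_add (by positivity) hδ.le, ENNReal.ofReal_add hR hM, ← hfst]
    refine (eLpNorm_add_le (hWm.add measurable_fst).aestronglyMeasurable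
      hEm.aestronglyMeasurable hp1).trans (add_le_add ?_ hE)
    exact (eLpNorm_add_le hWm.aestronglyMeasurable measurable_fst.aestronglyMeasurable
      hp1).trans (by gcongr)
  exact (ENNReal.ofReal_le_ofReal_iff (by positivity)).1 hfinal

lemma isProbabilityMeasure_empMeas {d N : ℕ} (hN : 1 ≤ N) (x : Fin N → Ed d) :
    IsProbabilityMeasure (empMeas x) := by
  refine ⟨?_⟩
  have : (N : ℝ≥0∞) ≠ 0 := by exact_mod_cast (by omega : N ≠ 0)
  simp [empMeas, ENNReal.inv_mul_cancel this (ENNReal.natCast_ne_top N)]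

lemma ae_empMeas_norm_le {d N : ℕ} (x : Fin N → Ed d) :
    ∀ᵐ z ∂empMeas x, ‖z‖ ≤ ∑ i, ‖x i‖ := by
  refine Measure.ae_smul_measure ?_ _
  rw [ae_finsetSum_measure_iff]
  intro i _
  rw [ae_dirac_eq]
  exact Finset.single_le_sum (f := fun j => ‖x j‖) (fun j _ => norm_nonneg _) (Finset.mem_univ i)

/-- for `G` Lipschitz wrt `d_1` with constant `L_G`, any minimizer `ν̄` in
the Hopf–Lax formula for `U(t, m_x^N)` has finite `p`-th moment for every `p ≥ 5`, with
`M_p(ν̄) ≤ L_G (T-t) + M_p(m_x^N)`. -/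
theorem minimizer_moment_bound {d N : ℕ} (hd : 1 ≤ d) (hN : 1 ≤ N)
    (T : ℝ) (hT : 0 < T)
    (G : Measure (Ed d) → ℝ) (LG : ℝ)
    (hGlip : ∀ μ ν : Measure (Ed d), IsP2 μ → IsP2 ν → |G μ - G ν| ≤ LG * d1 μ ν)
    (t : ℝ) (ht : 0 ≤ t) (htT : t < T) (x : Fin N → Ed d)
    (νb : Measure (Ed d)) (hνb : IsP2 νb)
    (hmin : G νb + (d2sq (empMeas x) νb).toReal / (2 * (T - t)) = MFval T G t (empMeas x)) :
    ∀ p : ℝ, 5 ≤ p →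
      Integrable (fun z : Ed d => ‖z‖ ^ p) νb ∧
      Mp p νb ≤ LG * (T - t) + Mp p (empMeas x) := by
  intro p hp
  have hτ : 0 < T - t := sub_pos.2 htT
  have hL := lipschitz_const_nonneg hd hGlip
  have := isProbabilityMeasure_empMeas hN x
  have hC := ae_empMeas_norm_le x
  have hm := isP2_of_ae_bound hC
  have hC0 : 0 ≤ ∑ i, ‖x i‖ := by positivity
  have hR : 0 ≤ LG * (T - t) := by positivity
  have hex : ∀ ε : ℝ, 0 < ε → ∃ π, IsCoupling π (empMeas x) νb ∧
      ∫ p, ‖(p.2 - p.1) - radialTrunc (LG * (T - t)) (p.2 - p.1)‖ ^ 2 ∂π ≤ ε := fun ε hε =>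
    exists_coupling_excess_le hL hτ hGlip hm hνb (fun ν hν => by
      rw [hmin]
      exact csInf_le (bddBelow_hopfLax hL hτ hGlip hm) ⟨ν, hν, rfl⟩) hε
  have hb := ae_bound_of_excess hm hνb hC0 hR hC hex
  have := hνb.1
  refine ⟨?_, Mp_le_of_excess hm hνb hC0 hR (by linarith) hC hex⟩
  have hp0 : 0 < p := by linarith
  have h := (MemLp.of_bound (p := ENNReal.ofReal p) aestronglyMeasurable_id _
    hb).integrable_norm_rpow (by simpa using hp0) ENNReal.ofReal_ne_top
  simpa only [ENNReal.toReal_ofReal hp0.le, id] using h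

end
end
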